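/- arXiv:1603.07216 — 4 statements merged into one kernel-verified Lean document; each statement's English description precedes it below -/
import Mathlib

section
/- Suppose g₃(Λ) = 0 and let ω_p be a midpoint of Λ with ℘(ω_p) = 0. Then ω_p is a zero of ℘ of order exactly two: ℘(ω_p) = 0, ℘'(ω_p) = 0, and ℘''(ω_p) ≠ 0. -/
open Complex Filter Topology Set

/-- The lattice `{2n₁ω₁ + 2n₂ω₂ : n₁, n₂ ∈ ℤ}` generated by `2ω₁` and `2ω₂`. -/
def latticeSet (ω₁ ω₂ : ℂ) : Set ℂ :=
  {z | ∃ m n : ℤ, z = 2 * (m : ℂ) * ω₁ + 2 * (n : ℂ) * ω₂}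

/-- The Weierstrass ℘-function of the lattice `Λ`:
`℘(z) = z⁻² + Σ_{0 ≠ λ ∈ Λ} ((z - λ)⁻² - λ⁻²)`. -/
noncomputable def wp (Λ : Set ℂ) (z : ℂ) : ℂ :=
  z ^ (-2 : ℤ) + ∑' l : {l : ℂ // l ∈ Λ ∧ l ≠ 0}, ((z - l) ^ (-2 : ℤ) - (l : ℂ) ^ (-2 : ℤ))

/-- The invariant `g₃(Λ) = 140 Σ_{0 ≠ λ ∈ Λ} λ⁻⁶`. -/
noncomputable def g3 (Λ : Set ℂ) : ℂ :=
  140 * ∑' l : {l : ℂ // l ∈ Λ ∧ l ≠ 0}, (l : ℂ) ^ (-6 : ℤ)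

/-- The period pair `(2ω₁, 2ω₂)`. -/
noncomputable def doubledPeriodPair (ω₁ ω₂ : ℂ) (h : LinearIndependent ℝ ![ω₁, ω₂]) :
    PeriodPair where
  ω₁ := 2 * ω₁
  ω₂ := 2 * ω₂
  indep := by
    have h2 := h.units_smul fun _ ↦ Units.mk0 (2 : ℝ) two_ne_zero
    convert! h2 using 1
    ext i
    fin_cases i <;> simp [Units.smul_def]

theorem coe_lattice_doubledPeriodPair (ω₁ ω₂ : ℂ) (h : LinearIndependent ℝ ![ω₁, ω₂]) :
    ((doubledPeriodPair ω₁ ω₂ h).lattice : Set ℂ) = latticeSet ω₁ ω₂ := by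
  ext z
  simp only [SetLike.mem_coe, PeriodPair.mem_lattice, doubledPeriodPair, latticeSet, mem_ofPred_eq]
  refine exists_congr fun m ↦ exists_congr fun n ↦ ⟨fun h ↦ ?_, fun h ↦ ?_⟩
  · rw [← h]; ring
  · rw [h]; ring

theorem PeriodPair.tsum_lattice_ne_zero (L : PeriodPair) (f : ℂ → ℂ) :
    ∑' l : {l : ℂ // l ∈ (L.lattice : Set ℂ) ∧ l ≠ 0}, f l =
      ∑' l : L.lattice, if (l : ℂ) = 0 then 0 else f l := by
  classical
  have h1 := tsum_subtype {l : ℂ | l ∈ (L.lattice : Set ℂ) ∧ l ≠ 0} f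
  have h2 := tsum_subtype (L.lattice : Set ℂ) fun l ↦ if l = 0 then 0 else f l
  refine h1.trans (Eq.trans (tsum_congr fun l ↦ ?_) h2.symm)
  by_cases hl : l ∈ L.lattice <;> by_cases h0 : l = 0 <;> simp [indicator, hl, h0]

theorem PeriodPair.wp_lattice (L : PeriodPair) : wp L.lattice = L.weierstrassP := by
  ext z
  have h := L.weierstrassPExcept_add 0 z
  have hsum := L.tsum_lattice_ne_zero fun l ↦ (z - l) ^ (-2 : ℤ) - l ^ (-2 : ℤ)
  rw [wp, hsum, ← h, PeriodPair.weierstrassPExcept, add_comm]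
  simp [zpow_neg, zpow_ofNat]

theorem PeriodPair.g3_lattice (L : PeriodPair) : g3 L.lattice = L.g₃ := by
  rw [g3, L.tsum_lattice_ne_zero fun l ↦ l ^ (-6 : ℤ), PeriodPair.g₃, PeriodPair.G]
  congr 1
  refine tsum_congr fun l ↦ ?_
  split_ifs with h
  · simp [h]
  · simp [zpow_neg, zpow_ofNat]

theorem PeriodPair.analyticOrderAt_weierstrassP_ne_top (L : PeriodPair) {z : ℂ}
    (hz : z ∉ L.lattice) : analyticOrderAt L.weierstrassP z ≠ ⊤ := by
  have h : meromorphicOrderAt L.weierstrassP z ≠ ⊤ :=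
    L.meromorphic_weierstrassP.exists_meromorphicOrderAt_ne_top_iff_forall.1
      ⟨0, by
        rw [L.order_weierstrassP 0 L.lattice.zero_mem]
        exact WithTop.coe_ne_top (a := (-2 : ℤ))⟩ z
  rw [(L.analyticOnNhd_weierstrassP z hz).meromorphicOrderAt_eq] at h
  intro h'
  simp [h'] at h

/-- A nonconstant analytic solution of `f'² = 4f³ - cf` has only double zeros. -/
theorem analyticOrderAt_eq_two_of_deriv_sq {f : ℂ → ℂ} {z₀ c : ℂ} (hf : AnalyticAt ℂ f z₀)
    (hzero : f z₀ = 0) (htop : analyticOrderAt f z₀ ≠ ⊤)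
    (heq : ∀ᶠ z in 𝓝 z₀, deriv f z ^ 2 = 4 * f z ^ 3 - c * f z) :
    analyticOrderAt f z₀ = 2 := by
  have hconst : AnalyticAt ℂ (fun _ : ℂ ↦ (4 : ℂ)) z₀ := analyticAt_const
  have hd := hf.analyticOrderAt_deriv_add_one
  simp only [hzero, sub_zero] at hd
  have hfactor : AnalyticAt ℂ (fun z ↦ 4 * f z ^ 2 - c) z₀ := by fun_prop
  have hord : analyticOrderAt (deriv f ^ 2) z₀ =
      analyticOrderAt (f * fun z ↦ 4 * f z ^ 2 - c) z₀ := by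
    refine analyticOrderAt_congr ?_
    filter_upwards [heq] with z hz
    simp only [Pi.pow_apply, Pi.mul_apply, hz]
    ring
  rw [analyticOrderAt_pow hf.deriv, analyticOrderAt_mul hf hfactor] at hord
  have hfactor_order : analyticOrderAt (fun z ↦ 4 * f z ^ 2 - c) z₀ =
      if c = 0 then 2 * analyticOrderAt f z₀ else 0 := by
    split_ifs with hc
    · have : (fun z ↦ 4 * f z ^ 2 - c) = (fun _ ↦ 4) * f ^ 2 := by ext; simp [hc]
      have h4 : analyticOrderAt (fun _ : ℂ ↦ (4 : ℂ)) z₀ = 0 := by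
        simp [hconst.analyticOrderAt_eq_zero]
      rw [this, analyticOrderAt_mul hconst (hf.pow 2), analyticOrderAt_pow hf, h4]
      simp
    · simpa [hfactor.analyticOrderAt_eq_zero, hzero] using hc
  rw [hfactor_order, ← hd] at hord
  rw [← hd] at htop ⊢
  generalize analyticOrderAt (deriv f) z₀ = k at hord htop ⊢
  cases k with
  | top => simp at htop
  | coe k =>
    split_ifs at hord
    · simp only [nsmul_eq_mul] at hord
      norm_cast at hord
      omega
    · simp only [nsmul_eq_mul] at hord
      norm_cast at hord ⊢
      omega

/-- If `g₃(Λ) = 0` and `ω` is a midpoint of `Λ` with `℘(ω) = 0`, then `ω` is a zero of `℘`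
of order exactly two: `℘(ω) = 0`, `℘'(ω) = 0`, and `℘''(ω) ≠ 0`. -/
theorem stmt2 (ω₁ ω₂ : ℂ) (hindep : LinearIndependent ℝ ![ω₁, ω₂])
    (hg₃ : g3 (latticeSet ω₁ ω₂) = 0)
    (ω : ℂ) (hω : ω ∉ latticeSet ω₁ ω₂) (h2ω : 2 * ω ∈ latticeSet ω₁ ω₂)
    (hzero : wp (latticeSet ω₁ ω₂) ω = 0) :
    wp (latticeSet ω₁ ω₂) ω = 0 ∧
      deriv (wp (latticeSet ω₁ ω₂)) ω = 0 ∧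
      iteratedDeriv 2 (wp (latticeSet ω₁ ω₂)) ω ≠ 0 := by
  have hL := coe_lattice_doubledPeriodPair ω₁ ω₂ hindep
  generalize doubledPeriodPair ω₁ ω₂ hindep = L at hL
  rw [← hL] at hg₃ hω hzero ⊢
  rw [L.wp_lattice] at hzero ⊢
  rw [L.g3_lattice] at hg₃
  have hf := L.analyticOnNhd_weierstrassP ω hω
  have heq : ∀ᶠ z in 𝓝 ω,
      deriv L.weierstrassP z ^ 2 = 4 * L.weierstrassP z ^ 3 - L.g₂ * L.weierstrassP z := by
    filter_upwards [L.isClosed_lattice.isOpen_compl.mem_nhds hω] with z hz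
    rw [L.deriv_weierstrassP, L.derivWeierstrassP_sq z hz, hg₃, sub_zero]
  have horder := analyticOrderAt_eq_two_of_deriv_sq hf hzero
    (L.analyticOrderAt_weierstrassP_ne_top hω) heq
  obtain ⟨hlt, hne⟩ := (analyticOrderAt_eq_nat_iff_iteratedDeriv_eq_zero hf (n := 2)).1
    (by exact_mod_cast horder)
  exact ⟨hzero, by simpa using hlt 1 one_lt_two, hne⟩
end

section
/- If g₃(Λ) = 0 then the Weierstrass function ℘ = ℘_Λ admits a global meromorphic square-root: there exists a meromorphic function f on ℂ with f(z)² = ℘(z) for all z. -/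
open Complex Filter Topology Set

/-- A nowhere vanishing holomorphic function on a disc has a holomorphic square root. -/
lemma AnalyticOnNhd.exists_sq_eq_on_ball {g : ℂ → ℂ} {c : ℂ} {r : ℝ}
    (hg : AnalyticOnNhd ℂ g (Metric.ball c r)) (hg₀ : ∀ z ∈ Metric.ball c r, g z ≠ 0) :
    ∃ h : ℂ → ℂ, AnalyticOnNhd ℂ h (Metric.ball c r) ∧ ∀ z ∈ Metric.ball c r, h z ^ 2 = g z := by
  have hlog : DifferentiableOn ℂ (logDeriv g) (Metric.ball c r) :=
    hg.deriv.differentiableOn.div hg.differentiableOn hg₀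
  obtain ⟨G, hG⟩ := hlog.isExactOn_ball
  have hderiv : ∀ z ∈ Metric.ball c r, HasDerivAt (fun z ↦ g z * exp (-G z)) 0 z := by
    intro z hz
    convert! (hg z hz).differentiableAt.hasDerivAt.mul (hG z hz).neg.cexp using 1
    rw [logDeriv_apply]
    field_simp [hg₀ z hz]
    ring
  obtain ⟨a, ha⟩ := Metric.isOpen_ball.exists_is_const_of_deriv_eq_zero
    (convex_ball c r).isPreconnected
    (fun z hz ↦ (hderiv z hz).differentiableAt.differentiableWithinAt)
    (fun z hz ↦ (hderiv z hz).deriv)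
  obtain ⟨b, hb⟩ := IsSquare.exists_sq a (IsAlgClosed.exists_eq_mul_self a)
  refine ⟨fun z ↦ b * exp (G z / 2), ?_, fun z hz ↦ ?_⟩
  · refine DifferentiableOn.analyticOnNhd (fun z hz ↦ ?_) Metric.isOpen_ball
    exact (((hG z hz).div_const 2).cexp.const_mul b).differentiableAt.differentiableWithinAt
  · rw [mul_pow, ← hb, ← ha z hz, ← Complex.exp_nat_mul, mul_assoc, ← Complex.exp_add]
    simp [mul_div_cancel₀]

/-- On a disc, a meromorphic function all of whose orders are even has a meromorphic
square root. -/
lemma Meromorphic.exists_sq_eq_on_ball {F : ℂ → ℂ} (hF : Meromorphic F)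
    (heven : ∀ z, ∃ n : ℤ, meromorphicOrderAt F z = ((2 * n : ℤ) : WithTop ℤ)) (c : ℂ) (r : ℝ) :
    ∃ f : ℂ → ℂ, MeromorphicOn f (Metric.ball c r) ∧
      ∀ x ∈ Metric.ball c r, ∀ᶠ z in 𝓝[≠] x, f z ^ 2 = F z := by
  choose n hn using heven
  have hF' (U : Set ℂ) : MeromorphicOn F U := fun z _ ↦ hF z
  set D := MeromorphicOn.divisor F (Metric.ball c r) with hD
  have hDfin : D.support.Finite := MeromorphicOn.divisor_ball_support_finite (hF' _)
  obtain ⟨g, hg, hg₀, hFg⟩ := (hF' (Metric.ball c r)).extract_zeros_poles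
    (fun u ↦ by rw [hn]; exact WithTop.coe_ne_top) hDfin
  obtain ⟨h, hh, hhg⟩ := hg.exists_sq_eq_on_ball (fun z hz ↦ hg₀ ⟨z, hz⟩)
  have hDeven : ∀ u, D u = 2 * (D u / 2) := by
    intro u
    by_cases hu : u ∈ Metric.ball c r
    · have : D u = 2 * n u := by
        rw [hD, MeromorphicOn.divisor_apply (hF' _) hu, hn, WithTop.untop₀_coe]
      omega
    · simp [D.apply_eq_zero_of_notMem hu]
  set P : ℂ → ℂ := ∏ᶠ u, (· - u) ^ (D u / 2) with hP
  have hsupp : (Function.mulSupport fun u : ℂ ↦ (· - u) ^ (D u / 2)).Finite := by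
    rw [Function.FactorizedRational.mulSupport fun u ↦ D u / 2]
    refine hDfin.subset fun u hu hu₀ ↦ hu ?_
    change D u / 2 = 0
    rw [hu₀, Int.zero_ediv]
  have hP2 : P ^ 2 = ∏ᶠ u, (· - u) ^ D u := by
    rw [hP, finprod_pow hsupp]
    refine finprod_congr fun u ↦ ?_
    ext z
    simp only [Pi.pow_apply]
    conv_rhs => rw [hDeven u, mul_comm, zpow_mul]
    norm_cast
  refine ⟨P * h, ?_, fun x hx ↦ ?_⟩
  · exact (Function.FactorizedRational.meromorphicNFOn _ _).meromorphicOn.mul hh.meromorphicOn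
  · have h₁ := mem_codiscreteWithin_iff_forall_mem_nhdsNE.1 hFg x hx
    filter_upwards [h₁, nhdsWithin_le_nhds (Metric.isOpen_ball.mem_nhds hx)] with z hz hzb
    have hz' : F z = ((∏ᶠ u, (· - u) ^ D u) • g) z := by
      rcases hz with hz | hz
      · exact hz
      · exact absurd hzb hz
    rw [hz', Pi.smul_apply', ← hP2, ← hhg z hzb]
    simp [mul_pow]

/-- A meromorphic square root on a disc can be chosen to agree, near the center, with any given
square root. -/
lemma Meromorphic.exists_sq_eq_on_ball_of_germ {F f₀ : ℂ → ℂ} (hF : Meromorphic F)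
    (heven : ∀ z, ∃ n : ℤ, meromorphicOrderAt F z = ((2 * n : ℤ) : WithTop ℤ)) {c : ℂ} {r : ℝ}
    (hr : 0 < r) (hf₀ : MeromorphicAt f₀ c) (hf₀F : ∀ᶠ z in 𝓝[≠] c, f₀ z ^ 2 = F z) :
    ∃ f : ℂ → ℂ, MeromorphicOn f (Metric.ball c r) ∧
      (∀ x ∈ Metric.ball c r, ∀ᶠ z in 𝓝[≠] x, f z ^ 2 = F z) ∧ f =ᶠ[𝓝[≠] c] f₀ := by
  obtain ⟨f, hf, hfF⟩ := hF.exists_sq_eq_on_ball heven c r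
  have hc := Metric.mem_ball_self (x := c) hr
  have hmul : meromorphicOrderAt ((f - f₀) * (f + f₀)) c = ⊤ := by
    rw [meromorphicOrderAt_eq_top_iff]
    filter_upwards [hfF c hc, hf₀F] with z h₁ h₂
    simp only [Pi.mul_apply, Pi.sub_apply, Pi.add_apply]
    linear_combination h₁ - h₂
  rw [meromorphicOrderAt_mul ((hf c hc).sub hf₀) ((hf c hc).add hf₀), WithTop.add_eq_top,
    meromorphicOrderAt_eq_top_iff, meromorphicOrderAt_eq_top_iff] at hmul
  rcases hmul with h | h
  · exact ⟨f, hf, hfF, h.mono fun z hz ↦ sub_eq_zero.1 hz⟩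
  · refine ⟨-f, hf.neg, fun x hx ↦ ?_, h.mono fun z hz ↦ ?_⟩
    · simpa using hfF x hx
    · exact neg_eq_of_add_eq_zero_right hz

/-- Two meromorphic functions on a preconnected set that agree near one point agree near every
point. -/
lemma MeromorphicOn.eventuallyEq_nhdsNE_of_isPreconnected {f g : ℂ → ℂ} {U : Set ℂ}
    (hf : MeromorphicOn f U) (hg : MeromorphicOn g U) (hU : IsPreconnected U) {x y : ℂ}
    (hx : x ∈ U) (hy : y ∈ U) (h : f =ᶠ[𝓝[≠] x] g) : f =ᶠ[𝓝[≠] y] g := by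
  have hx' : meromorphicOrderAt (f - g) x = ⊤ :=
    meromorphicOrderAt_eq_top_iff.2 (h.mono fun z hz ↦ sub_eq_zero.2 hz)
  have hy' : meromorphicOrderAt (f - g) y = ⊤ := by
    by_contra hy'
    exact (hf.sub hg).meromorphicOrderAt_ne_top_of_isPreconnected hU hy hx hy' hx'
  exact (meromorphicOrderAt_eq_top_iff.1 hy').mono fun z hz ↦ sub_eq_zero.1 hz

/-- A meromorphic function on the plane all of whose orders are even has a global meromorphic
square root. -/
theorem Meromorphic.exists_sq_eq {F : ℂ → ℂ} (hF : Meromorphic F)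
    (heven : ∀ z, ∃ n : ℤ, meromorphicOrderAt F z = ((2 * n : ℤ) : WithTop ℤ)) :
    ∃ f : ℂ → ℂ, Meromorphic f ∧ ∀ z, f z ^ 2 = F z := by
  obtain ⟨f₀, hf₀, hf₀F⟩ := hF.exists_sq_eq_on_ball heven 0 1
  have h0 : (0 : ℂ) ∈ Metric.ball (0 : ℂ) 1 := by simp
  have hpos (n : ℕ) : (0 : ℝ) < n + 1 := by positivity
  choose s hs hsF hs₀ using fun n : ℕ ↦
    hF.exists_sq_eq_on_ball_of_germ heven (hpos n) (hf₀ 0 h0) (hf₀F 0 h0)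
  have hagree {m n : ℕ} (hmn : m ≤ n) {x : ℂ} (hx : x ∈ Metric.ball (0 : ℂ) (m + 1)) :
      s m =ᶠ[𝓝[≠] x] s n := by
    have hsub : Metric.ball (0 : ℂ) (m + 1) ⊆ Metric.ball 0 (n + 1) :=
      Metric.ball_subset_ball (by gcongr)
    exact (hs m).eventuallyEq_nhdsNE_of_isPreconnected (fun z hz ↦ hs n z (hsub hz))
      (convex_ball _ _).isPreconnected (Metric.mem_ball_self (hpos m)) hx
      ((hs₀ m).trans (hs₀ n).symm)
  choose q hq using fun z ↦ IsSquare.exists_sq (F z) (IsAlgClosed.exists_eq_mul_self (F z))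
  classical
  let f : ℂ → ℂ := fun z ↦ if s ⌈‖z‖⌉₊ z ^ 2 = F z then s ⌈‖z‖⌉₊ z else q z
  refine ⟨f, fun x ↦ ?_, fun z ↦ ?_⟩
  · set N := ⌈‖x‖⌉₊ + 1 with hN
    have hxN : x ∈ Metric.ball (0 : ℂ) (N + 1) := by
      have := Nat.le_ceil ‖x‖
      simp only [mem_ball_zero_iff, hN]
      push_cast
      linarith
    refine (hs N x hxN).congr ?_
    have hall : ∀ᶠ z in 𝓝[≠] x, ∀ k ∈ Finset.range (N + 1), ‖x‖ < k + 1 → s k z = s N z := by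
      refine (Finset.eventually_all _).2 fun k hk ↦ ?_
      by_cases hxk : ‖x‖ < k + 1
      · filter_upwards [hagree (Finset.mem_range_succ_iff.1 hk) (x := x) (by simpa using hxk)]
          with z hz _ using hz
      · exact Eventually.of_forall fun z h ↦ absurd h hxk
    have hnear : ∀ᶠ z in 𝓝[≠] x, z ∈ Metric.ball x 1 :=
      nhdsWithin_le_nhds (Metric.ball_mem_nhds x one_pos)
    filter_upwards [hall, hnear, hsF N x hxN] with z hz hzx hzF
    rw [mem_ball_iff_norm] at hzx
    have h₁ : ‖z‖ < ‖x‖ + 1 := by linarith [norm_sub_norm_le z x]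
    have h₂ : ‖x‖ < ‖z‖ + 1 := by linarith [norm_sub_norm_le x z, norm_sub_rev x z]
    have h₃ : ⌈‖z‖⌉₊ ≤ N := Nat.ceil_le.2 (by rw [hN]; push_cast; linarith [Nat.le_ceil ‖x‖])
    have h₄ := hz ⌈‖z‖⌉₊ (Finset.mem_range_succ_iff.2 h₃) (by linarith [Nat.le_ceil ‖z‖])
    simp [f, h₄, hzF]
  · by_cases h : s ⌈‖z‖⌉₊ z ^ 2 = F z
    · simp [f, h]
    · simp [f, h, ← hq]

namespace PeriodPair

/-- `℘` does not vanish identically near any point. -/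
lemma meromorphicOrderAt_weierstrassP_ne_top (L : PeriodPair) (z : ℂ) :
    meromorphicOrderAt L.weierstrassP z ≠ ⊤ :=
  MeromorphicOn.meromorphicOrderAt_ne_top_of_isPreconnected (x := 0) (U := univ)
    (fun z _ ↦ L.meromorphic_weierstrassP z) isPreconnected_univ (mem_univ _) (mem_univ _)
    (by rw [L.order_weierstrassP 0 (zero_mem _)]; decide)

/-- If `g₃ = 0`, all zeros and poles of `℘` have even order. -/
lemma exists_meromorphicOrderAt_weierstrassP_eq_two_mul (L : PeriodPair) (hg₃ : L.g₃ = 0) (z : ℂ) :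
    ∃ n : ℤ, meromorphicOrderAt L.weierstrassP z = ((2 * n : ℤ) : WithTop ℤ) := by
  by_cases hz : z ∈ L.lattice
  · exact ⟨-1, (L.order_weierstrassP z hz).trans (by norm_num)⟩
  obtain ⟨n, hn⟩ := WithTop.ne_top_iff_exists.1 (L.meromorphicOrderAt_weierstrassP_ne_top z)
  rcases eq_or_ne n 0 with rfl | hn₀
  · exact ⟨0, by simpa using hn.symm⟩
  have han : AnalyticAt ℂ L.weierstrassP z := L.analyticOnNhd_weierstrassP z hz
  have hderiv : meromorphicOrderAt L.derivWeierstrassP z = ((n - 1 : ℤ) : WithTop ℤ) := by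
    rw [← L.deriv_weierstrassP]
    exact meromorphicOrderAt_deriv_eq_sub_one (by exact_mod_cast hn₀) hn.symm
  set Q : ℂ → ℂ := fun w ↦ 4 * L.weierstrassP w ^ 2 - L.g₂ with hQdef
  have hQ : AnalyticAt ℂ Q z := by fun_prop
  have heq : L.derivWeierstrassP * L.derivWeierstrassP =ᶠ[𝓝[≠] z] L.weierstrassP * Q := by
    filter_upwards [nhdsWithin_le_nhds (L.isClosed_lattice.isOpen_compl.mem_nhds hz)] with w hw
    rw [Pi.mul_apply, Pi.mul_apply, ← sq, L.derivWeierstrassP_sq w hw, hg₃]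
    simp only [hQdef]
    ring
  have hord := meromorphicOrderAt_congr heq
  have hderiv_mer := L.meromorphic_derivWeierstrassP z
  rw [meromorphicOrderAt_mul hderiv_mer hderiv_mer,
    meromorphicOrderAt_mul han.meromorphicAt hQ.meromorphicAt, hderiv, ← hn] at hord
  by_cases hg₂ : L.g₂ = 0
  · have hQ' : Q = (fun _ ↦ (4 : ℂ)) * (L.weierstrassP * L.weierstrassP) := by
      ext w
      simp [hQdef, hg₂, sq]
    rw [hQ', meromorphicOrderAt_mul_of_ne_zero analyticAt_const (by norm_num),
      meromorphicOrderAt_mul han.meromorphicAt han.meromorphicAt, ← hn] at hord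
    have hord' : (n - 1) + (n - 1) = n + (n + n) := by exact_mod_cast hord
    exact ⟨-1, by rw [← hn]; congr 1; omega⟩
  · have hn_nonneg : 0 ≤ n := by
      have := han.meromorphicOrderAt_nonneg
      rw [← hn] at this
      exact_mod_cast this
    have hzero : L.weierstrassP z = 0 := by
      by_contra h
      have h₁ : meromorphicOrderAt L.weierstrassP z = 0 := by
        simp [han.meromorphicOrderAt_eq, han.analyticOrderAt_eq_zero.2 h]
      rw [← hn] at h₁
      exact hn₀ (by exact_mod_cast h₁)
    have hQz : meromorphicOrderAt Q z = 0 := by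
      have : Q z ≠ 0 := by simp [hQdef, hzero, hg₂]
      simp [hQ.meromorphicOrderAt_eq, hQ.analyticOrderAt_eq_zero.2 this]
    rw [hQz, add_zero] at hord
    have hord' : (n - 1) + (n - 1) = n := by exact_mod_cast hord
    exact ⟨1, by rw [← hn]; congr 1; omega⟩

/-- The period pair generating `latticeSet ω₁ ω₂`. -/
noncomputable def ofHalfPeriods (ω₁ ω₂ : ℂ) (h : LinearIndependent ℝ ![ω₁, ω₂]) : PeriodPair where
  ω₁ := 2 * ω₁
  ω₂ := 2 * ω₂
  indep := by
    rw [LinearIndependent.pair_iff] at h ⊢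
    intro s t hst
    refine h s t ?_
    simp only [real_smul] at hst ⊢
    linear_combination hst / 2

lemma mem_lattice_ofHalfPeriods {ω₁ ω₂ : ℂ} (h : LinearIndependent ℝ ![ω₁, ω₂]) {z : ℂ} :
    z ∈ (ofHalfPeriods ω₁ ω₂ h).lattice ↔ z ∈ latticeSet ω₁ ω₂ := by
  rw [mem_lattice, latticeSet, mem_ofPred_eq]
  refine exists₂_congr fun m n ↦ ?_
  simp only [ofHalfPeriods]
  rw [eq_comm]
  ring_nf

/-- Split off the zero vector from a sum over the lattice. -/
lemma tsum_lattice_eq {ω₁ ω₂ : ℂ} (h : LinearIndependent ℝ ![ω₁, ω₂]) {φ : ℂ → ℂ}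
    (hφ : Summable fun l : (ofHalfPeriods ω₁ ω₂ h).lattice ↦ φ l) :
    ∑' l : (ofHalfPeriods ω₁ ω₂ h).lattice, φ l =
      φ 0 + ∑' l : {l : ℂ // l ∈ latticeSet ω₁ ω₂ ∧ l ≠ 0}, φ l := by
  classical
  rw [hφ.tsum_eq_add_tsum_ite 0, ZeroMemClass.coe_zero]
  congr 1
  let e : {l : ℂ // l ∈ latticeSet ω₁ ω₂ ∧ l ≠ 0} → (ofHalfPeriods ω₁ ω₂ h).lattice :=
    fun l ↦ ⟨l, (mem_lattice_ofHalfPeriods h).2 l.2.1⟩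
  have he : Function.Injective e := fun a b hab ↦ Subtype.ext (Subtype.mk.inj hab)
  rw [← he.tsum_eq]
  · refine tsum_congr fun l ↦ (if_neg fun h₀ ↦ l.2.2 (congrArg Subtype.val h₀))
  · intro l hl
    have hl₀ : l ≠ 0 := fun h₀ ↦ hl (if_pos h₀)
    exact ⟨⟨l, (mem_lattice_ofHalfPeriods h).1 l.2, by simpa using hl₀⟩, rfl⟩

lemma weierstrassP_ofHalfPeriods {ω₁ ω₂ : ℂ} (h : LinearIndependent ℝ ![ω₁, ω₂]) (z : ℂ) :
    (ofHalfPeriods ω₁ ω₂ h).weierstrassP z = wp (latticeSet ω₁ ω₂) z := by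
  have := tsum_lattice_eq h (φ := fun l ↦ 1 / (z - l) ^ 2 - 1 / l ^ 2)
    ((ofHalfPeriods ω₁ ω₂ h).hasSum_weierstrassP z).summable
  rw [weierstrassP, this, wp]
  simp [zpow_neg, zpow_ofNat]

lemma g₃_ofHalfPeriods {ω₁ ω₂ : ℂ} (h : LinearIndependent ℝ ![ω₁, ω₂]) :
    (ofHalfPeriods ω₁ ω₂ h).g₃ = g3 (latticeSet ω₁ ω₂) := by
  have := tsum_lattice_eq h (φ := fun l ↦ (l ^ 6)⁻¹)
    (by simpa using ((ofHalfPeriods ω₁ ω₂ h).hasSum_sumInvPow 0 (r := 6) (by norm_num)).summable)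
  rw [g₃, G, this, g3]
  simp [zpow_neg, zpow_ofNat]

end PeriodPair

/-- If `g₃(Λ) = 0` then `℘_Λ` admits a global meromorphic square-root. -/
theorem stmt3 (ω₁ ω₂ : ℂ) (hindep : LinearIndependent ℝ ![ω₁, ω₂])
    (hg₃ : g3 (latticeSet ω₁ ω₂) = 0) :
    ∃ f : ℂ → ℂ, MeromorphicOn f Set.univ ∧
      ∀ z ∉ latticeSet ω₁ ω₂, f z ^ 2 = wp (latticeSet ω₁ ω₂) z := by
  obtain ⟨f, hf, hfsq⟩ := Meromorphic.exists_sq_eq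
    (PeriodPair.ofHalfPeriods ω₁ ω₂ hindep).meromorphic_weierstrassP
    (PeriodPair.exists_meromorphicOrderAt_weierstrassP_eq_two_mul _
      ((PeriodPair.g₃_ofHalfPeriods hindep).trans hg₃))
  exact ⟨f, fun z _ ↦ hf z, fun z _ ↦
    (hfsq z).trans (PeriodPair.weierstrassP_ofHalfPeriods hindep z)⟩
end

section
/- For the lattice Λ = {2m + 2ni : m, n ∈ ℤ} of even Gaussian integers, the Weierstrass function vanishes at 1 + i: ℘(1 + i) = 0 (equivalently ℘(-1 - i) = 0). -/
open Complex Filter Topology Set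

/-- The period pair `(2, 2i)`, whose lattice is that of the even Gaussian integers. -/
noncomputable def evenGaussianPair : PeriodPair where
  ω₁ := 2
  ω₂ := 2 * I
  indep := by
    rw [LinearIndependent.pair_iff]
    intro s t h
    simpa [Complex.ext_iff] using h

theorem mem_lattice_evenGaussianPair {z : ℂ} :
    z ∈ evenGaussianPair.lattice ↔ z ∈ latticeSet 1 I := by
  rw [PeriodPair.mem_lattice]
  constructor
  · rintro ⟨m, n, h⟩
    exact ⟨m, n, by rw [← h]; simp only [evenGaussianPair]; ring⟩
  · rintro ⟨m, n, h⟩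
    exact ⟨m, n, by rw [h]; simp only [evenGaussianPair]; ring⟩

/-- `wp` agrees with Mathlib's Weierstrass function of the same lattice. -/
theorem wp_eq_weierstrassP (L : PeriodPair) (Λ : Set ℂ) (h : ∀ z, z ∈ L.lattice ↔ z ∈ Λ)
    (z : ℂ) : wp Λ z = L.weierstrassP z := by
  have hsub : ∑' l : {l : ℂ // l ∈ Λ ∧ l ≠ 0}, ((z - l) ^ (-2 : ℤ) - (l : ℂ) ^ (-2 : ℤ)) =
      L.weierstrassPExcept 0 z := by
    have h₁ := tsum_subtype {l : ℂ | l ∈ Λ ∧ l ≠ 0}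
      (fun l ↦ (z - l) ^ (-2 : ℤ) - l ^ (-2 : ℤ))
    have h₂ := tsum_subtype (L.lattice : Set ℂ)
      (fun l ↦ if l = 0 then 0 else (1 / (z - l) ^ 2 - 1 / l ^ 2))
    refine h₁.trans (Eq.trans ?_ h₂.symm)
    congr 1
    ext l
    by_cases hl : l ∈ Λ <;> by_cases h0 : l = 0 <;>
      simp [Set.indicator, h, hl, h0, zpow_neg]
  have hP := L.weierstrassPExcept_add 0 z
  simp only [ZeroMemClass.coe_zero] at hP
  rw [wp, hsub, ← hP, zpow_neg]
  norm_cast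
  simp [add_comm]

/-- On a lattice stable under multiplication by `i`, `℘(iz) = -℘(z)`. -/
theorem weierstrassP_I_mul (L : PeriodPair) (h : ∀ z ∈ L.lattice, I * z ∈ L.lattice) (z : ℂ) :
    L.weierstrassP (I * z) = -L.weierstrassP z := by
  let e : L.lattice ≃ L.lattice :=
    { toFun := fun l ↦ ⟨I * l, h l l.2⟩
      invFun := fun l ↦ ⟨-(I * l), neg_mem (h l l.2)⟩
      left_inv := fun l ↦ by ext; simp [← mul_assoc]
      right_inv := fun l ↦ by ext; simp [← mul_assoc] }
  rw [PeriodPair.weierstrassP, PeriodPair.weierstrassP, ← tsum_neg, ← e.tsum_eq]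
  refine tsum_congr fun l ↦ ?_
  change 1 / (I * z - I * l) ^ 2 - 1 / (I * l) ^ 2 = _
  rw [← mul_sub, mul_pow, mul_pow, I_sq]
  simp only [neg_one_mul, one_div, inv_neg]
  ring

/-- For the lattice `Λ = {2m + 2ni : m, n ∈ ℤ}` of even Gaussian integers, the Weierstrass
function vanishes at `1 + i` (equivalently, at `-1 - i`). -/
theorem stmt9 :
    wp (latticeSet 1 Complex.I) (1 + Complex.I) = 0 ∧
      wp (latticeSet 1 Complex.I) (-1 - Complex.I) = 0 := by
  have key : evenGaussianPair.weierstrassP (1 + I) = 0 := by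
    have hrot := weierstrassP_I_mul evenGaussianPair (fun z hz ↦ by
      rw [mem_lattice_evenGaussianPair] at hz ⊢
      obtain ⟨m, n, rfl⟩ := hz
      refine ⟨-n, m, ?_⟩
      push_cast
      linear_combination (2 * n : ℂ) * I_mul_I) (1 + I)
    have hper := evenGaussianPair.weierstrassP_sub_coe (1 + I) ⟨2, evenGaussianPair.ω₁_mem_lattice⟩
    have hpt : I * (1 + I) = 1 + I - 2 := by linear_combination I_mul_I
    rw [hpt, hper] at hrot
    exact self_eq_neg.mp hrot
  have hwp := wp_eq_weierstrassP evenGaussianPair (latticeSet 1 I)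
    fun _ ↦ mem_lattice_evenGaussianPair
  refine ⟨by rw [hwp, key], ?_⟩
  rw [hwp, ← neg_add', PeriodPair.weierstrassP_neg, key]
end

section
/- For any lattice Λ ⊂ ℂ, the fourth-order Eisenstein function ζ₄(z) = Σ_{λ∈Λ} (z-λ)⁻⁴ admits a global meromorphic square-root on ℂ if and only if g₂(Λ) = 0; in that case ℘ and -℘ are such square-roots. -/
open Complex Filter Topology Set

/-- The invariant `g₂(Λ) = 60 Σ_{0 ≠ λ ∈ Λ} λ⁻⁴`. -/
noncomputable def g2 (Λ : Set ℂ) : ℂ :=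
  60 * ∑' l : {l : ℂ // l ∈ Λ ∧ l ≠ 0}, (l : ℂ) ^ (-4 : ℤ)

/-- The fourth-order Eisenstein function `ζ₄(z) = Σ_{λ ∈ Λ} (z - λ)⁻⁴`. -/
noncomputable def zeta4 (Λ : Set ℂ) (z : ℂ) : ℂ :=
  ∑' l : Λ, (z - (l : ℂ)) ^ (-4 : ℤ)

open scoped PeriodPair

/-- A zero of an analytic function admitting a local meromorphic square root is not simple. -/
lemma AnalyticAt.deriv_eq_zero_of_meromorphicAt_sq {f G : ℂ → ℂ} {z : ℂ}
    (hG : AnalyticAt ℂ G z) (hGz : G z = 0) (hf : MeromorphicAt f z)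
    (hfG : ∀ᶠ w in 𝓝[≠] z, f w ^ 2 = G w) : deriv G z = 0 := by
  by_contra hd
  have h₁ : meromorphicOrderAt G z = 1 := by
    have h := hG.analyticOrderAt_sub_eq_one_of_deriv_ne_zero hd
    simp only [hGz, sub_zero] at h
    rw [hG.meromorphicOrderAt_eq, h]
    rfl
  have hfG' : f ^ 2 =ᶠ[𝓝[≠] z] G := hfG
  rw [← meromorphicOrderAt_congr hfG', meromorphicOrderAt_pow hf] at h₁
  cases h : meromorphicOrderAt f z with
  | top =>
    rw [h] at h₁
    exact absurd h₁ (by decide)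
  | coe n =>
    rw [h] at h₁
    have h₂ : (2 : ℤ) * n = 1 := WithTop.coe_injective h₁
    omega

namespace PeriodPair

variable (L : PeriodPair)

lemma deriv_derivWeierstrassP {z : ℂ} (hz : z ∉ L.lattice) :
    deriv ℘'[L] z = 6 * L.sumInvPow z 4 := by
  rw [← L.deriv_derivWeierstrassPExcept_self z, L.derivWeierstrassPExcept_of_notMem z hz]

lemma analyticAt_weierstrassP {z : ℂ} (hz : z ∉ L.lattice) : AnalyticAt ℂ ℘[L] z :=
  L.analyticOnNhd_weierstrassP z hz

lemma analyticAt_derivWeierstrassP {z : ℂ} (hz : z ∉ L.lattice) : AnalyticAt ℂ ℘'[L] z :=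
  L.analyticOnNhd_derivWeierstrassP z hz

lemma hasDerivAt_weierstrassP {z : ℂ} (hz : z ∉ L.lattice) :
    HasDerivAt ℘[L] (℘'[L] z) z := by
  simpa using (L.analyticAt_weierstrassP hz).differentiableAt.hasDerivAt

lemma eventually_notMem_lattice {z : ℂ} (hz : z ∉ L.lattice) : ∀ᶠ w in 𝓝 z, w ∉ L.lattice :=
  L.isClosed_lattice.isOpen_compl.mem_nhds hz

lemma meromorphicOrderAt_derivWeierstrassP_ne_top (z : ℂ) :
    meromorphicOrderAt ℘'[L] z ≠ ⊤ := by
  refine L.meromorphic_derivWeierstrassP.exists_meromorphicOrderAt_ne_top_iff_forall.mp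
    ⟨0, ?_⟩ z
  have h := meromorphicOrderAt_deriv_eq_sub_one (f := ℘[L]) (x := 0) (n := -2) (by norm_num)
    (by rw [L.order_weierstrassP 0 L.lattice.zero_mem]; rfl)
  rw [L.deriv_weierstrassP] at h
  simp [h]

/-- The second derivative of `℘` is `6 ℘² - g₂ / 2`. -/
lemma deriv_derivWeierstrassP_eq {z : ℂ} (hz : z ∉ L.lattice) :
    deriv ℘'[L] z = 6 * ℘[L] z ^ 2 - L.g₂ / 2 := by
  have hmul : ∀ w ∉ L.lattice, ℘'[L] w ≠ 0 →
      deriv ℘'[L] w = 6 * ℘[L] w ^ 2 - L.g₂ / 2 := by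
    intro w hw hne
    have hP := L.hasDerivAt_weierstrassP hw
    have hlhs := (L.analyticAt_derivWeierstrassP hw).differentiableAt.hasDerivAt.pow 2
    have hrhs := (((hP.pow 3).const_mul 4).sub (hP.const_mul L.g₂)).sub_const L.g₃
    have heq := hlhs.unique <| hrhs.congr_of_eventuallyEq <|
      (L.eventually_notMem_lattice hw).mono fun u hu ↦ L.derivWeierstrassP_sq u hu
    apply mul_left_cancel₀ hne
    norm_num at heq
    linear_combination heq / 2
  have hne : ∀ᶠ w in 𝓝[≠] z, ℘'[L] w ≠ 0 :=
    (meromorphicOrderAt_ne_top_iff_eventually_ne_zero (L.meromorphic_derivWeierstrassP z)).mp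
      (L.meromorphicOrderAt_derivWeierstrassP_ne_top z)
  have hlhs := (L.analyticAt_derivWeierstrassP hz).deriv.continuousAt
  have hrhs : ContinuousAt (fun w ↦ 6 * ℘[L] w ^ 2 - L.g₂ / 2) z := by
    have := (L.analyticAt_weierstrassP hz).continuousAt
    fun_prop
  refine tendsto_nhds_unique_of_eventuallyEq (l := 𝓝[≠] z)
    (hlhs.tendsto.mono_left nhdsWithin_le_nhds)
    (hrhs.tendsto.mono_left nhdsWithin_le_nhds) ?_
  filter_upwards [hne, nhdsWithin_le_nhds (L.eventually_notMem_lattice hz)] with w h₁ h₂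
  exact hmul w h₂ h₁

lemma sumInvPow_four {z : ℂ} (hz : z ∉ L.lattice) :
    L.sumInvPow z 4 = ℘[L] z ^ 2 - L.g₂ / 12 := by
  linear_combination (L.deriv_derivWeierstrassP_eq hz - L.deriv_derivWeierstrassP hz) / 6

/-- The Weierstrass `℘`-function takes every finite value. -/
lemma exists_weierstrassP_eq (a : ℂ) : ∃ z ∉ L.lattice, ℘[L] z = a := by
  classical
  by_contra! hne
  let h : ℂ → ℂ := fun z ↦ if z ∈ L.lattice then 0 else (℘[L] z - a)⁻¹
  have hana : ∀ z, AnalyticAt ℂ h z := by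
    intro z
    by_cases hz : z ∈ L.lattice
    · refine .of_meromorphicOrderAt_pos ?_ (if_pos hz)
      have hcongr : h =ᶠ[𝓝[≠] z] (℘[L] + fun _ ↦ -a)⁻¹ := by
        filter_upwards [self_mem_nhdsWithin,
          mem_nhdsWithin_of_mem_nhds (L.compl_lattice_sdiff_singleton_mem_nhds z)] with w hw hw'
        have : w ∉ L.lattice := fun hmem ↦ hw' ⟨hmem, hw⟩
        simp [h, this, sub_eq_add_neg]
      have hord := L.order_weierstrassP z hz
      rw [meromorphicOrderAt_congr hcongr, meromorphicOrderAt_inv,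
        meromorphicOrderAt_add_eq_left_of_lt (.const _ _), hord]
      · decide
      · rw [hord]
        exact lt_of_lt_of_le (by decide) analyticAt_const.meromorphicOrderAt_nonneg
    · have hcongr : (fun w ↦ (℘[L] w - a)⁻¹) =ᶠ[𝓝 z] h :=
        (L.eventually_notMem_lattice hz).mono fun w hw ↦ (if_neg hw).symm
      exact (((L.analyticAt_weierstrassP hz).sub analyticAt_const).inv
        (sub_ne_zero.mpr (hne z hz))).congr hcongr
  have hdiff : Differentiable ℂ h := fun z ↦ (hana z).differentiableAt
  have hper : ∀ z w, w ∈ L.lattice → h (z + w) = h z := by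
    intro z w hw
    have hmem : z + w ∈ L.lattice ↔ z ∈ L.lattice :=
      L.lattice.toAddSubgroup.add_mem_cancel_right hw
    simp only [h, hmem, L.weierstrassP_add_coe z ⟨w, hw⟩]
  have hconst := hdiff.apply_eq_apply_of_bounded
    (IsZLattice.isCompact_range_of_periodic L.lattice h hdiff.continuous hper).isBounded
    (L.ω₁ / 2) 0
  have hω := L.ω₁_div_two_notMem_lattice
  simp only [h, if_neg hω, if_pos L.lattice.zero_mem, inv_eq_zero, sub_eq_zero] at hconst
  exact hne _ hω hconst

/-- If `∑ (l - z)⁻⁴` has a meromorphic square root, then any zero of it is a critical point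
of `℘`, which determines the value of `℘` there in terms of `g₂` and `g₃`. -/
lemma g₂_mul_weierstrassP_of_meromorphicAt_sq {f : ℂ → ℂ} {z : ℂ} (hz : z ∉ L.lattice)
    (hf : MeromorphicAt f z) (hsq : ∀ w ∉ L.lattice, f w ^ 2 = L.sumInvPow w 4)
    (hg : L.g₂ ≠ 0) (hP : ℘[L] z ^ 2 = L.g₂ / 12) : 2 * L.g₂ * ℘[L] z = -3 * L.g₃ := by
  have hPz := L.analyticAt_weierstrassP hz
  have hsq' : ∀ᶠ w in 𝓝[≠] z, f w ^ 2 = ℘[L] w ^ 2 - L.g₂ / 12 :=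
    nhdsWithin_le_nhds <| (L.eventually_notMem_lattice hz).mono fun w hw ↦
      (hsq w hw).trans (L.sumInvPow_four hw)
  have hderiv := AnalyticAt.deriv_eq_zero_of_meromorphicAt_sq
    (G := fun w ↦ ℘[L] w ^ 2 - L.g₂ / 12) (by fun_prop) (by simp [hP]) hf hsq'
  have hP₀ : ℘[L] z ≠ 0 := by
    intro h₀
    apply hg
    linear_combination -12 * hP + 12 * ℘[L] z * h₀
  rw [(((L.hasDerivAt_weierstrassP hz).fun_pow 2).sub_const _).deriv] at hderiv
  have hP' : ℘'[L] z = 0 := by simpa [hP₀] using hderiv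
  have hode := L.derivWeierstrassP_sq z hz
  rw [hP'] at hode
  linear_combination 3 * hode + 12 * ℘[L] z * hP

lemma g₂_eq_zero_of_meromorphicOn_sq {f : ℂ → ℂ} (hf : MeromorphicOn f univ)
    (hsq : ∀ w ∉ L.lattice, f w ^ 2 = L.sumInvPow w 4) : L.g₂ = 0 := by
  by_contra hg
  obtain ⟨a, ha⟩ := IsAlgClosed.exists_pow_nat_eq (L.g₂ / 12) (n := 2) (by norm_num)
  obtain ⟨z, hz, hza⟩ := L.exists_weierstrassP_eq a
  obtain ⟨w, hw, hwa⟩ := L.exists_weierstrassP_eq (-a)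
  have h₁ := L.g₂_mul_weierstrassP_of_meromorphicAt_sq hz (hf z (mem_univ _)) hsq hg (by rw [hza, ha])
  have h₂ := L.g₂_mul_weierstrassP_of_meromorphicAt_sq hw (hf w (mem_univ _)) hsq hg
    (by rw [hwa, neg_sq, ha])
  rw [hza] at h₁
  rw [hwa] at h₂
  have ha₀ : a = 0 := mul_left_cancel₀ hg (by linear_combination (h₁ - h₂) / 4)
  apply hg
  linear_combination -12 * ha + 12 * a * ha₀

lemma zeta4_lattice (z : ℂ) : zeta4 L.lattice z = L.sumInvPow z 4 := by
  refine tsum_congr fun l ↦ ?_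
  rw [zpow_neg, show (l.1 - z) ^ 4 = (z - l.1) ^ 4 by ring]
  rfl

lemma tsum_lattice_ne_zero_s15 (f : ℂ → ℂ) :
    ∑' l : {l : ℂ // l ∈ (L.lattice : Set ℂ) ∧ l ≠ 0}, f l =
      ∑' l : L.lattice, if (l : ℂ) = 0 then 0 else f l := by
  classical
  refine (tsum_subtype {l : ℂ | l ∈ (L.lattice : Set ℂ) ∧ l ≠ 0} f).trans (Eq.trans ?_
    (tsum_subtype (L.lattice : Set ℂ) fun l ↦ if l = 0 then 0 else f l).symm)
  refine tsum_congr fun l ↦ ?_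
  by_cases hl : l ∈ L.lattice <;> by_cases h₀ : l = 0 <;> simp [Set.indicator, hl, h₀]

lemma g2_lattice : g2 L.lattice = L.g₂ := by
  rw [g2, L.tsum_lattice_ne_zero_s15 fun l ↦ l ^ (-4 : ℤ), g₂, G]
  congr 1
  refine tsum_congr fun l ↦ ?_
  by_cases h₀ : (l : ℂ) = 0
  · simp [h₀]
  · rw [if_neg h₀, zpow_neg]
    rfl

lemma wp_lattice_s15 (z : ℂ) : wp L.lattice z = ℘[L] z := by
  rw [wp, L.tsum_lattice_ne_zero_s15 fun l ↦ (z - l) ^ (-2 : ℤ) - l ^ (-2 : ℤ),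
    ← L.weierstrassPExcept_add 0 z, weierstrassPExcept, add_comm]
  simp [zpow_neg, zpow_ofNat]

end PeriodPair

/-- The pair of periods `2ω₁`, `2ω₂` generating `latticeSet ω₁ ω₂`. -/
noncomputable def doublePeriodPair (ω₁ ω₂ : ℂ) (h : LinearIndependent ℝ ![ω₁, ω₂]) :
    PeriodPair where
  ω₁ := 2 * ω₁
  ω₂ := 2 * ω₂
  indep := by
    rw [LinearIndependent.pair_iff] at h ⊢
    intro s t hst
    refine h s t (mul_left_cancel₀ (two_ne_zero (α := ℂ)) ?_)
    simp only [Complex.real_smul] at hst ⊢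
    linear_combination hst

lemma latticeSet_eq_lattice (ω₁ ω₂ : ℂ) (h : LinearIndependent ℝ ![ω₁, ω₂]) :
    latticeSet ω₁ ω₂ = (doublePeriodPair ω₁ ω₂ h).lattice := by
  ext z
  simp only [latticeSet, Set.mem_ofPred_eq, SetLike.mem_coe, PeriodPair.mem_lattice,
    doublePeriodPair]
  refine exists₂_congr fun m n ↦ ⟨fun hz ↦ ?_, fun hz ↦ ?_⟩
  · rw [hz]; ring
  · rw [← hz]; ring

/-- For any lattice `Λ`, the Eisenstein function `ζ₄` admits a global meromorphic square-root
on `ℂ` if and only if `g₂(Λ) = 0`; in that case `℘` and `-℘` are such square-roots. -/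
theorem stmt15 (ω₁ ω₂ : ℂ) (hindep : LinearIndependent ℝ ![ω₁, ω₂]) :
    ((∃ f : ℂ → ℂ, MeromorphicOn f Set.univ ∧
        ∀ z ∉ latticeSet ω₁ ω₂, f z ^ 2 = zeta4 (latticeSet ω₁ ω₂) z) ↔
      g2 (latticeSet ω₁ ω₂) = 0) ∧
    (g2 (latticeSet ω₁ ω₂) = 0 → ∀ z ∉ latticeSet ω₁ ω₂,
      (wp (latticeSet ω₁ ω₂) z) ^ 2 = zeta4 (latticeSet ω₁ ω₂) z ∧
      (- wp (latticeSet ω₁ ω₂) z) ^ 2 = zeta4 (latticeSet ω₁ ω₂) z) := by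
  rw [latticeSet_eq_lattice ω₁ ω₂ hindep]
  set L := doublePeriodPair ω₁ ω₂ hindep
  simp only [L.g2_lattice, L.wp_lattice_s15, L.zeta4_lattice, SetLike.mem_coe, neg_sq, and_self]
  have hsq : L.g₂ = 0 → ∀ z ∉ L.lattice, ℘[L] z ^ 2 = L.sumInvPow z 4 := by
    intro hg z hz
    rw [L.sumInvPow_four hz, hg, zero_div, sub_zero]
  exact ⟨⟨fun ⟨f, hf, hfsq⟩ ↦ L.g₂_eq_zero_of_meromorphicOn_sq hf hfsq,
    fun hg ↦ ⟨℘[L], L.meromorphic_weierstrassP.meromorphicOn, hsq hg⟩⟩, hsq⟩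
end
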